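/- arXiv:2407.03366 — 3 statements merged into one kernel-verified Lean document; each statement's English description precedes it below -/
import Mathlib

section
/- Let n ≥ 2. Every element g of G = SO(1,n)_e admits a decomposition g = h·a_t·k with h ∈ H, t ∈ ℝ and k ∈ K, and also a decomposition g = k'·a_{t'}·h' with k' ∈ K, t' ∈ ℝ, h' ∈ H; i.e. G = HAK = KAH. -/
open scoped BigOperators
open Filter Topology

noncomputable section

/-- The Lorentzian bilinear form on `ℝ^{1+n}`. -/
def lformR (n : ℕ) (x y : Fin (n+1) → ℝ) : ℝ :=
  ∑ i, (if i = 0 then (-1 : ℝ) else 1) * x i * y i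

/-- The complex-bilinear Lorentzian form on `ℂ^{1+n}`. -/
def lformC (n : ℕ) (z w : Fin (n+1) → ℂ) : ℂ :=
  ∑ i, (if i = 0 then (-1 : ℂ) else 1) * z i * w i

/-- The matrix `η = diag(−1,1,…,1)`. -/
def eta (n : ℕ) : Matrix (Fin (n+1)) (Fin (n+1)) ℝ :=
  Matrix.diagonal (fun i => if i = 0 then (-1 : ℝ) else 1)

/-- Membership in `G = SO(1,n)_e`. -/
def memG (n : ℕ) (g : Matrix (Fin (n+1)) (Fin (n+1)) ℝ) : Prop :=
  g.transpose * eta n * g = eta n ∧ g.det = 1 ∧ 0 < g 0 0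

/-- Standard basis vector `e₀`. -/
def e0 (n : ℕ) : Fin (n+1) → ℝ := fun i => if i = 0 then 1 else 0

/-- Standard basis vector `eₙ`. -/
def elast (n : ℕ) : Fin (n+1) → ℝ := fun i => if i = Fin.last n then 1 else 0

/-- Membership in `H = SO(1,n−1)_e`, the stabilizer of `eₙ`. -/
def memH (n : ℕ) (g : Matrix (Fin (n+1)) (Fin (n+1)) ℝ) : Prop :=
  memG n g ∧ g.mulVec (elast n) = elast n

/-- Membership in `K = SO(n)`, the stabilizer of `e₀`. -/
def memK (n : ℕ) (g : Matrix (Fin (n+1)) (Fin (n+1)) ℝ) : Prop :=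
  memG n g ∧ g.mulVec (e0 n) = e0 n

/-- The boost `a_t`. -/
def boost (n : ℕ) (t : ℝ) : Matrix (Fin (n+1)) (Fin (n+1)) ℝ :=
  Matrix.of fun i j =>
    if i = 0 ∧ j = 0 then Real.cosh t
    else if i = Fin.last n ∧ j = Fin.last n then Real.cosh t
    else if (i = 0 ∧ j = Fin.last n) ∨ (i = Fin.last n ∧ j = 0) then Real.sinh t
    else if i = j then 1 else 0

/-- The upper hemisphere `S^n_+ = {(ix₀, 𝐱) : x₀ > 0, x₀² + |𝐱|² = 1}` in `ℂ^{1+n}`. -/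
def Snplus (n : ℕ) : Set (Fin (n+1) → ℂ) :=
  {z | ∃ x : Fin (n+1) → ℝ, 0 < x 0 ∧ (∑ i, (x i)^2) = 1 ∧
    z 0 = Complex.I * (x 0 : ℂ) ∧ ∀ i, i ≠ 0 → z i = (x i : ℂ)}

/-- The crown domain `Ξ = G · S^n_+ ⊂ ℂ^{1+n}`. -/
def Xi (n : ℕ) : Set (Fin (n+1) → ℂ) :=
  {z | ∃ g w, memG n g ∧ w ∈ Snplus n ∧ z = (g.map (Complex.ofReal)).mulVec w}

/-- The conjugate crown `Ξ̄`. -/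
def XiBar (n : ℕ) : Set (Fin (n+1) → ℂ) :=
  {z | (fun i => (starRingEnd ℂ) (z i)) ∈ Xi n}

/-- The de Sitter space `dS^n` viewed inside `ℂ^{1+n}`. -/
def dSC (n : ℕ) : Set (Fin (n+1) → ℂ) :=
  {z | (∀ i, (z i).im = 0) ∧ lformC n z z = 1}

/-- The cut `[1,∞) ⊂ ℂ`. -/
def slit : Set ℂ := {z | z.im = 0 ∧ 1 ≤ z.re}

/-- Componentwise complex conjugation on `ℂ^{1+n}`. -/
def conjVec (n : ℕ) (z : Fin (n+1) → ℂ) : Fin (n+1) → ℂ :=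
  fun i => (starRingEnd ℂ) (z i)

/-- `λ` is admissible: purely imaginary with nonnegative imaginary part, or
real with `0 < λ < ρ = (n−1)/2`. -/
def admissible (n : ℕ) (lam : ℂ) : Prop :=
  (lam.re = 0 ∧ 0 ≤ lam.im) ∨ (lam.im = 0 ∧ 0 < lam.re ∧ lam.re < ((n : ℝ) - 1)/2)

/-- Euler's integral representation of `₂F₁(ρ+λ, ρ−λ; n/2; ·)` on `ℂ∖[1,∞)`,
with `ρ = (n−1)/2`. -/
def Flam (n : ℕ) (lam : ℂ) (z : ℂ) : ℂ :=
  (Complex.Gamma ((n : ℂ)/2) /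
    (Complex.Gamma (((n : ℂ) - 1)/2 - lam) * Complex.Gamma (1/2 + lam))) *
  ∫ t in (0:ℝ)..1, (t : ℂ) ^ (((n : ℂ) - 1)/2 - lam - 1) *
    ((1 : ℂ) - (t : ℂ)) ^ (lam - 1/2) *
    ((1 : ℂ) - z * (t : ℂ)) ^ (-(((n : ℂ) - 1)/2) - lam)

/-- General term of the Gauss hypergeometric series `₂F₁(a,b;c;w)`. -/
def hypTerm (a b c : ℂ) (w : ℂ) (k : ℕ) : ℂ :=
  (ascPochhammer ℂ k).eval a * (ascPochhammer ℂ k).eval b /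
    ((ascPochhammer ℂ k).eval c * (k.factorial : ℂ)) * w ^ k

/-- The curve `z_t = (i cos t, 0, …, 0, sin t)` in the crown `Ξ`. -/
def zCurve (n : ℕ) (t : ℝ) : Fin (n+1) → ℂ :=
  fun i => if i = 0 then Complex.I * (Real.cos t : ℂ)
    else if i = Fin.last n then (Real.sin t : ℂ) else 0

/-- The curve `z̃_t = (−i cos t, 0, …, 0, sin t)` in the conjugate crown `Ξ̄`. -/
def zCurveBar (n : ℕ) (t : ℝ) : Fin (n+1) → ℂ :=
  fun i => if i = 0 then -Complex.I * (Real.cos t : ℂ)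
    else if i = Fin.last n then (Real.sin t : ℂ) else 0

/-- The open future cone `Γ⁺(eₙ)` in `dS^n`. -/
def futureCone (n : ℕ) : Set (Fin (n+1) → ℝ) :=
  {y | lformR n y y = 1 ∧ lformR n (y - elast n) (y - elast n) < 0 ∧ 0 < y 0}

/-- The open past cone `Γ⁻(eₙ)` in `dS^n`. -/
def pastCone (n : ℕ) : Set (Fin (n+1) → ℝ) :=
  {y | lformR n y y = 1 ∧ lformR n (y - elast n) (y - elast n) < 0 ∧ y 0 < 0}


/-- The boundary value expression in Statement 12 (sign `s = ∓1` for `x ± i0`). -/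
def bval (n : ℕ) (lam : ℂ) (x : ℝ) (s : ℝ) : ℂ :=
  (Complex.Gamma ((n : ℂ)/2) * Complex.Gamma ((2 - (n : ℂ))/2) /
      (Complex.Gamma (1/2 + lam) * Complex.Gamma (1/2 - lam))) *
    ∑' k : ℕ, hypTerm (((n : ℂ) - 1)/2 + lam) (((n : ℂ) - 1)/2 - lam) ((n : ℂ)/2)
      ((1 : ℂ) - x) k
  + Complex.exp ((s : ℂ) * (Real.pi : ℂ) * Complex.I * ((2 - (n : ℂ))/2)) *
      (((x - 1) ^ ((2 - (n : ℝ))/2) : ℝ) : ℂ) *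
      (Complex.Gamma ((n : ℂ)/2) * Complex.Gamma (((n : ℂ) - 2)/2) /
        (Complex.Gamma (((n : ℂ) - 1)/2 + lam) * Complex.Gamma (((n : ℂ) - 1)/2 - lam))) *
    ∑' k : ℕ, hypTerm (1/2 - lam) (1/2 + lam) ((4 - (n : ℂ))/2) ((1 : ℂ) - x) k

end

theorem elast_eq_single (n : ℕ) : elast n = Pi.single (Fin.last n) 1 := by
  ext i; simp [elast, Pi.single_apply]

theorem e0_eq_single (n : ℕ) : e0 n = Pi.single 0 1 := by
  ext i; simp [e0, Pi.single_apply]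

section Boost

variable {n : ℕ}

theorem boost_mulVec (hn : n ≠ 0) (t : ℝ) (x : Fin (n+1) → ℝ) (i : Fin (n+1)) :
    (boost n t).mulVec x i =
      if i = 0 then Real.cosh t * x 0 + Real.sinh t * x (Fin.last n)
      else if i = Fin.last n then Real.sinh t * x 0 + Real.cosh t * x (Fin.last n)
      else x i := by
  obtain ⟨m, rfl⟩ := Nat.exists_eq_succ_of_ne_zero hn
  have h0 : (0 : Fin (m+2)) ≠ Fin.last (m+1) := by simp [Fin.ext_iff]
  by_cases hi : i = 0
  · subst hi
    rw [Matrix.mulVec, dotProduct, Finset.sum_eq_add 0 (Fin.last (m+1)) h0]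
    · simp [boost, h0, h0.symm]
    · rintro j - ⟨hj, hj'⟩
      simp [boost, hj, hj', hj.symm, h0]
    · simp
    · simp
  by_cases hl : i = Fin.last (m+1)
  · subst hl
    rw [Matrix.mulVec, dotProduct, Finset.sum_eq_add 0 (Fin.last (m+1)) h0]
    · simp [boost, h0, h0.symm]
    · rintro j - ⟨hj, hj'⟩
      simp [boost, hj, hj', hj'.symm, h0.symm]
    · simp
    · simp
  · simp [Matrix.mulVec, dotProduct, boost, hi, hl]

theorem boost_mul_boost (hn : n ≠ 0) (s t : ℝ) : boost n s * boost n t = boost n (s + t) := by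
  have h0 : (0 : Fin (n+1)) ≠ Fin.last n := by simpa [Fin.ext_iff] using hn.symm
  refine Matrix.ext_of_mulVec_single fun j => ?_
  rw [← Matrix.mulVec_mulVec]
  ext i
  simp only [boost_mulVec hn, if_true, if_neg h0.symm, Real.cosh_add, Real.sinh_add]
  split_ifs <;> ring

theorem boost_zero (n : ℕ) : boost n 0 = 1 := by
  ext i j
  simp only [boost, Matrix.of_apply, Matrix.one_apply, Real.cosh_zero, Real.sinh_zero]
  split_ifs <;> grind

theorem boost_transpose (n : ℕ) (t : ℝ) : (boost n t).transpose = boost n t := by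
  ext i j
  simp only [boost, Matrix.of_apply, Matrix.transpose_apply]
  split_ifs <;> grind

theorem boost_mulVec_elast (hn : n ≠ 0) (t : ℝ) :
    (boost n t).mulVec (elast n) = Real.sinh t • e0 n + Real.cosh t • elast n := by
  have h0 : (0 : Fin (n+1)) ≠ Fin.last n := by simpa [Fin.ext_iff] using hn.symm
  ext i
  rw [boost_mulVec hn]
  by_cases hi : i = 0
  · simp [hi, elast, e0, h0]
  · by_cases hl : i = Fin.last n <;> simp [hi, hl, elast, e0, h0, h0.symm]

end Boost

section Group

variable {n : ℕ} {g h : Matrix (Fin (n+1)) (Fin (n+1)) ℝ}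

theorem eta_mul_eta (n : ℕ) : eta n * eta n = 1 := by
  rw [eta, Matrix.diagonal_mul_diagonal, ← Matrix.diagonal_one]
  congr 1
  ext i
  split_ifs <;> norm_num

theorem eta_mul_boost_mul_eta (hn : n ≠ 0) (t : ℝ) :
    eta n * boost n t * eta n = boost n (-t) := by
  have h0 : (0 : Fin (n+1)) ≠ Fin.last n := by simpa [Fin.ext_iff] using hn.symm
  ext i j
  simp only [eta, Matrix.mul_diagonal, Matrix.diagonal_mul, boost, Matrix.of_apply,
    Real.cosh_neg, Real.sinh_neg]
  split_ifs <;> grind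

theorem memG_boost (hn : n ≠ 0) (t : ℝ) : memG n (boost n t) := by
  have key (s : ℝ) : (boost n s).transpose * eta n * boost n s = eta n := by
    calc (boost n s).transpose * eta n * boost n s
        = boost n s * (eta n * boost n s * eta n) * eta n := by
          simp only [boost_transpose, Matrix.mul_assoc, eta_mul_eta, Matrix.mul_one]
      _ = eta n := by
          rw [eta_mul_boost_mul_eta hn, boost_mul_boost hn, add_neg_cancel, boost_zero,
            Matrix.one_mul]
  refine ⟨key t, ?_, ?_⟩
  · have hη : (eta n).det ≠ 0 := fun h => by
      simpa [h] using congrArg Matrix.det (eta_mul_eta n)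
    have hd := congrArg Matrix.det (key (t / 2))
    rw [Matrix.det_mul, Matrix.det_mul, Matrix.det_transpose] at hd
    rw [← add_halves t, ← boost_mul_boost hn, Matrix.det_mul]
    exact mul_right_cancel₀ hη (by linarith)
  · simp [boost, Real.cosh_pos]

theorem memG.inv_mul (hg : memG n g) : eta n * g.transpose * eta n * g = 1 := by
  rw [Matrix.mul_assoc, Matrix.mul_assoc, ← Matrix.mul_assoc g.transpose, hg.1, eta_mul_eta]

theorem memG.mul_inv (hg : memG n g) : g * (eta n * g.transpose * eta n) = 1 :=
  mul_eq_one_comm.mp hg.inv_mul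

theorem memG.mul_eta_mul_transpose (hg : memG n g) : g * eta n * g.transpose = eta n := by
  calc g * eta n * g.transpose = g * (eta n * g.transpose * eta n) * eta n := by
        simp only [Matrix.mul_assoc, eta_mul_eta, Matrix.mul_one]
    _ = eta n := by rw [hg.mul_inv, Matrix.one_mul]

theorem memG.inv (hg : memG n g) : memG n (eta n * g.transpose * eta n) := by
  have hηt : (eta n).transpose = eta n := by simp [eta]
  refine ⟨?_, ?_, ?_⟩
  · calc (eta n * g.transpose * eta n).transpose * eta n * (eta n * g.transpose * eta n)
        = eta n * (g * (eta n * eta n * eta n) * g.transpose) * eta n := by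
          simp only [Matrix.transpose_mul, Matrix.transpose_transpose, hηt, Matrix.mul_assoc]
      _ = eta n := by
          rw [eta_mul_eta, Matrix.one_mul, hg.mul_eta_mul_transpose, eta_mul_eta, Matrix.one_mul]
  · have := congrArg Matrix.det hg.mul_inv
    rwa [Matrix.det_mul, hg.2.1, one_mul, Matrix.det_one] at this
  · simpa [eta] using hg.2.2

theorem memG.transpose (hg : memG n g) : memG n g.transpose :=
  ⟨by simpa using hg.mul_eta_mul_transpose, by simpa using hg.2.1, by simpa using hg.2.2⟩

theorem memG.sq_zero_zero (hg : memG n g) : g 0 0 ^ 2 = 1 + ∑ i : Fin n, g i.succ 0 ^ 2 := by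
  have := congrFun (congrFun hg.1 0) 0
  rw [Matrix.mul_apply, Fin.sum_univ_succ] at this
  simp only [eta, Matrix.mul_diagonal, Matrix.transpose_apply, Matrix.diagonal_apply_eq,
    if_true, Fin.succ_ne_zero, if_false, mul_one, ← sq] at this
  linarith

theorem memG.mul (hg : memG n g) (hh : memG n h) : memG n (g * h) := by
  refine ⟨?_, by rw [Matrix.det_mul, hg.2.1, hh.2.1, one_mul], ?_⟩
  · calc (g * h).transpose * eta n * (g * h)
        = h.transpose * (g.transpose * eta n * g) * h := by
          simp only [Matrix.transpose_mul, Matrix.mul_assoc]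
      _ = eta n := by rw [hg.1, hh.1]
  · rw [Matrix.mul_apply, Fin.sum_univ_succ]
    have h1 := hg.transpose.sq_zero_zero
    have h2 := hh.sq_zero_zero
    simp only [Matrix.transpose_apply] at h1
    have cs := Finset.sum_mul_sq_le_sq_mul_sq Finset.univ
      (fun i : Fin n => g 0 i.succ) (fun i : Fin n => h i.succ 0)
    have hA : 0 ≤ ∑ i : Fin n, g 0 i.succ ^ 2 := Finset.sum_nonneg fun i _ => sq_nonneg _
    have hB : 0 ≤ ∑ i : Fin n, h i.succ 0 ^ 2 := Finset.sum_nonneg fun i _ => sq_nonneg _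
    have hlt : (∑ i : Fin n, g 0 i.succ * h i.succ 0) ^ 2 < (g 0 0 * h 0 0) ^ 2 := by
      rw [mul_pow, h1, h2]
      nlinarith
    linarith [(abs_lt_of_sq_lt_sq' hlt (mul_pos hg.2.2 hh.2.2).le).1]

theorem memK_of_transpose_mul_self (hg : g.transpose * g = 1) (hdet : g.det = 1)
    (he : g.mulVec (e0 n) = e0 n) : memK n g := by
  have hη : eta n = 1 - (2 : ℝ) • Matrix.vecMulVec (e0 n) (e0 n) := by
    ext i j
    by_cases hij : i = j
    · subst hij
      by_cases hi : i = 0 <;> simp [eta, e0, Matrix.vecMulVec_apply, hi]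
      norm_num
    · by_cases hi : i = 0
      · subst hi
        simp [eta, e0, Matrix.vecMulVec_apply, hij, Ne.symm hij]
      · simp [eta, e0, Matrix.vecMulVec_apply, hij, hi]
  have he' : g.transpose.mulVec (e0 n) = e0 n := by
    conv_lhs => rw [← he]
    rw [Matrix.mulVec_mulVec, hg, Matrix.one_mulVec]
  refine ⟨⟨?_, hdet, ?_⟩, he⟩
  · rw [hη, Matrix.mul_sub, Matrix.sub_mul, Matrix.mul_one, hg, Matrix.mul_smul, Matrix.smul_mul,
      Matrix.mul_vecMulVec, Matrix.vecMulVec_mul, he', ← Matrix.mulVec_transpose, he']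
  · have := congrFun he 0
    rw [e0_eq_single, Matrix.mulVec_single_one] at this
    simp at this
    simp [this]

theorem memK.inv (hg : memK n g) : memK n (eta n * g.transpose * eta n) := by
  refine ⟨hg.1.inv, ?_⟩
  conv_lhs => rw [← hg.2]
  rw [Matrix.mulVec_mulVec, hg.1.inv_mul, Matrix.one_mulVec]

theorem memH.inv (hg : memH n g) : memH n (eta n * g.transpose * eta n) := by
  refine ⟨hg.1.inv, ?_⟩
  conv_lhs => rw [← hg.2]
  rw [Matrix.mulVec_mulVec, hg.1.inv_mul, Matrix.one_mulVec]

end Group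

/-- The matrix of the orthogonal reflection in the hyperplane orthogonal to `v`. -/
noncomputable def householder {ι : Type*} [Fintype ι] [DecidableEq ι] (v : ι → ℝ) : Matrix ι ι ℝ :=
  1 - (2 / (v ⬝ᵥ v)) • Matrix.vecMulVec v v

section Householder

variable {ι : Type*} [Fintype ι] [DecidableEq ι] {v : ι → ℝ}

theorem householder_mulVec (v x : ι → ℝ) :
    (householder v).mulVec x = x - (2 / (v ⬝ᵥ v) * (v ⬝ᵥ x)) • v := by
  ext i
  simp [householder, Matrix.sub_mulVec, Matrix.smul_mulVec, Matrix.vecMulVec_mulVec]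
  ring

theorem householder_transpose (v : ι → ℝ) : (householder v).transpose = householder v := by
  simp [householder, Matrix.transpose_vecMulVec]

theorem householder_mul_self (hv : v ≠ 0) : householder v * householder v = 1 := by
  have hvv : v ⬝ᵥ v ≠ 0 := by simpa using hv
  refine Matrix.ext_of_mulVec_single fun j => ?_
  rw [← Matrix.mulVec_mulVec, Matrix.one_mulVec, householder_mulVec, householder_mulVec]
  ext i
  simp only [dotProduct_sub, dotProduct_smul, Pi.sub_apply, Pi.smul_apply, smul_eq_mul]
  field_simp
  ring

theorem det_householder (hv : v ≠ 0) : (householder v).det = -1 := by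
  have hvv : v ⬝ᵥ v ≠ 0 := by simpa using hv
  have : householder v = 1 + Matrix.vecMulVec (-(2 / (v ⬝ᵥ v)) • v) v := by
    rw [householder, Matrix.smul_vecMulVec, neg_smul, sub_eq_add_neg]
  rw [this, Matrix.vecMulVec_eq Unit, Matrix.det_one_add_replicateCol_mul_replicateRow,
    dotProduct_smul, smul_eq_mul]
  field_simp
  norm_num

end Householder

theorem exists_memK_mulVec_elast {n : ℕ} (hn : 2 ≤ n) (u : Fin (n+1) → ℝ) (hu0 : u 0 = 0)
    (hu : u ⬝ᵥ u = 1) :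
    ∃ k, memK n k ∧ k.mulVec (elast n) = u := by
  by_cases huv : u = elast n
  · exact ⟨1, memK_of_transpose_mul_self (by simp) (by simp) (by simp), by simp [huv]⟩
  have h0 : (0 : Fin (n+1)) ≠ Fin.last n := by simp [Fin.ext_iff]; omega
  have h1 : (⟨1, by omega⟩ : Fin (n+1)) ≠ Fin.last n := by simp [Fin.ext_iff]; omega
  have h10 : 0 ≠ (⟨1, by omega⟩ : Fin (n+1)) := by simp [Fin.ext_iff]
  set v := u - elast n with hv
  have hv0 : v ≠ 0 := sub_ne_zero.mpr huv
  set w : Fin (n+1) → ℝ := Pi.single ⟨1, by omega⟩ 1 with hw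
  have hw0 : w ≠ 0 := by simp [hw]
  have hwl : (householder w).mulVec (elast n) = elast n := by
    rw [householder_mulVec]
    simp [hw, elast, h1]
  have hvl : (householder v).mulVec (elast n) = u := by
    have hvv : v ⬝ᵥ v ≠ 0 := by simpa using hv0
    have hve : 2 * (v ⬝ᵥ elast n) = -(v ⬝ᵥ v) := by
      have hl : elast n ⬝ᵥ elast n = 1 := by simp [elast_eq_single]
      simp only [hv, sub_dotProduct, dotProduct_sub, hu, hl, dotProduct_comm (elast n) u]
      ring
    rw [householder_mulVec, div_mul_eq_mul_div, hve, neg_div, div_self hvv, hv]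
    simp
  refine ⟨householder v * householder w, memK_of_transpose_mul_self ?_ ?_ ?_, ?_⟩
  · rw [Matrix.transpose_mul, householder_transpose, householder_transpose, Matrix.mul_assoc,
      ← Matrix.mul_assoc (householder v), householder_mul_self hv0, Matrix.one_mul,
      householder_mul_self hw0]
  · rw [Matrix.det_mul, det_householder hv0, det_householder hw0]
    norm_num
  · rw [← Matrix.mulVec_mulVec, householder_mulVec w, householder_mulVec]
    simp [e0_eq_single, hw, hv, hu0, elast, h0, h10]
  · rw [← Matrix.mulVec_mulVec, hwl, hvl]

theorem exists_memK_boost_memH {n : ℕ} (hn : 2 ≤ n) {g : Matrix (Fin (n+1)) (Fin (n+1)) ℝ}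
    (hg : memG n g) : ∃ k t h, memK n k ∧ memH n h ∧ g = k * boost n t * h := by
  have hn0 : n ≠ 0 := by omega
  have h0 : Fin.last n ≠ 0 := by simpa [Fin.ext_iff] using hn0
  set x := g.mulVec (elast n) with hx
  have hxi (i) : x i = g i (Fin.last n) := by
    simp [hx, elast_eq_single]
  have hform : ∑ i : Fin n, x i.succ ^ 2 = 1 + x 0 ^ 2 := by
    have := congrFun (congrFun hg.1 (Fin.last n)) (Fin.last n)
    rw [Matrix.mul_apply, Fin.sum_univ_succ] at this
    simp only [eta, Matrix.mul_diagonal, Matrix.transpose_apply, Matrix.diagonal_apply_eq,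
      if_true, Fin.succ_ne_zero, if_false, mul_one, h0] at this
    simp only [hxi, sq]
    linarith
  set t := Real.arsinh (x 0) with ht
  have hs : Real.sinh t = x 0 := Real.sinh_arsinh _
  have hc : 0 < Real.cosh t := Real.cosh_pos t
  have hcs : Real.cosh t ^ 2 = 1 + x 0 ^ 2 := by rw [Real.cosh_sq, hs, add_comm]
  set u : Fin (n+1) → ℝ := fun i => if i = 0 then 0 else x i / Real.cosh t with hu
  obtain ⟨k, hk, hku⟩ := exists_memK_mulVec_elast hn u (by simp [hu]) (by
    rw [dotProduct, Fin.sum_univ_succ]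
    simp only [hu, if_true, Fin.succ_ne_zero, if_false, ← sq, div_pow, ← Finset.sum_div, hform,
      hcs]
    field_simp
    simp)
  have hkx : k.mulVec ((boost n t).mulVec (elast n)) = x := by
    rw [boost_mulVec_elast hn0, Matrix.mulVec_add, Matrix.mulVec_smul, Matrix.mulVec_smul,
      hk.2, hku]
    ext i
    by_cases hi : i = 0
    · simp [hi, e0, hu, hs]
    · simp [hi, e0, hu]
      field_simp
  have hb : boost n (-t) * boost n t = 1 := by
    rw [boost_mul_boost hn0, neg_add_cancel, boost_zero]
  refine ⟨k, t, boost n (-t) * ((eta n * k.transpose * eta n) * g), hk,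
    ⟨(memG_boost hn0 _).mul (hk.1.inv.mul hg), ?_⟩, ?_⟩
  · rw [← Matrix.mulVec_mulVec, ← Matrix.mulVec_mulVec, ← hx, ← hkx, Matrix.mulVec_mulVec _ _ k,
      hk.1.inv_mul, Matrix.one_mulVec, Matrix.mulVec_mulVec, hb, Matrix.one_mulVec]
  · rw [Matrix.mul_assoc k, ← Matrix.mul_assoc (boost n t), mul_eq_one_comm.mp hb, Matrix.one_mul,
      ← Matrix.mul_assoc, hk.1.mul_inv, Matrix.one_mul]

open Filter Topology in
theorem stmt0 (n : ℕ) (hn : 2 ≤ n) (g : Matrix (Fin (n+1)) (Fin (n+1)) ℝ)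
    (hg : memG n g) :
    (∃ (h : Matrix (Fin (n+1)) (Fin (n+1)) ℝ) (t : ℝ) (k : Matrix (Fin (n+1)) (Fin (n+1)) ℝ),
      memH n h ∧ memK n k ∧ g = h * boost n t * k) ∧
    (∃ (k : Matrix (Fin (n+1)) (Fin (n+1)) ℝ) (t : ℝ) (h : Matrix (Fin (n+1)) (Fin (n+1)) ℝ),
      memK n k ∧ memH n h ∧ g = k * boost n t * h) := by
  refine ⟨?_, exists_memK_boost_memH hn hg⟩
  obtain ⟨k, t, h, hk, hh, hkh⟩ := exists_memK_boost_memH hn hg.inv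
  have hn0 : n ≠ 0 := by omega
  refine ⟨_, -t, _, hh.inv, hk.inv, ?_⟩
  have hb : boost n (-t) * boost n t = 1 := by
    rw [boost_mul_boost hn0, neg_add_cancel, boost_zero]
  set h' := eta n * h.transpose * eta n with hh'
  set k' := eta n * k.transpose * eta n with hk'
  have hinv : h' * boost n (-t) * k' * (eta n * g.transpose * eta n) = 1 := by
    calc h' * boost n (-t) * k' * (eta n * g.transpose * eta n)
        = h' * (boost n (-t) * ((k' * k) * boost n t)) * h := by
          simp only [hkh, Matrix.mul_assoc]
      _ = 1 := by rw [hk.1.inv_mul, Matrix.one_mul, hb, Matrix.mul_one, hh.1.inv_mul]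
  exact (left_inv_eq_right_inv hinv hg.inv_mul).symm
end

section
/- Let n ≥ 2. The de Sitter space dS^n equals the intersection of the topological boundaries of the crown domain Ξ and of its conjugate Ξ̄; concretely, dS^n = (closure(Ξ) ∖ Ξ) ∩ (closure(Ξ̄) ∖ Ξ̄), where closures are taken in ℂ^{1+n}. -/
open scoped BigOperators
open Filter Topology

open Matrix in
theorem lformC_eq_dotProduct (n : ℕ) (z w : Fin (n+1) → ℂ) :
    lformC n z w = z ⬝ᵥ ((eta n).map Complex.ofReal *ᵥ w) := by
  have h : (eta n).map Complex.ofReal =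
      Matrix.diagonal (fun i : Fin (n+1) => if i = 0 then (-1 : ℂ) else 1) := by
    ext i j
    by_cases hij : i = j <;> by_cases hi : i = 0 <;> simp [eta, hij, hi, Matrix.diagonal_apply]
    all_goals split_ifs <;> simp
  simp only [lformC, h, dotProduct, Matrix.mulVec_diagonal]
  exact Finset.sum_congr rfl fun i _ => by ring

open Matrix in
theorem lformC_mulVec {n : ℕ} {g : Matrix (Fin (n+1)) (Fin (n+1)) ℝ}
    (hg : gᵀ * eta n * g = eta n) (z w : Fin (n+1) → ℂ) :
    lformC n (g.map Complex.ofReal *ᵥ z) (g.map Complex.ofReal *ᵥ w) = lformC n z w := by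
  have h : (g.map Complex.ofReal)ᵀ * (eta n).map Complex.ofReal * g.map Complex.ofReal =
      (eta n).map Complex.ofReal := by
    conv_rhs => rw [← hg]
    ext i j
    simp [Matrix.mul_apply]
  rw [lformC_eq_dotProduct n z w, ← h, ← Matrix.mulVec_mulVec, ← Matrix.mulVec_mulVec,
    Matrix.dotProduct_mulVec z, Matrix.vecMul_transpose, lformC_eq_dotProduct]

theorem lformC_self_of_mem_Snplus {n : ℕ} {w : Fin (n+1) → ℂ} (hw : w ∈ Snplus n) :
    lformC n w w = 1 := by
  obtain ⟨x, -, hx, h0, hi⟩ := hw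
  have h : lformC n w w = ((∑ i, x i ^ 2 : ℝ) : ℂ) := by
    rw [lformC, Complex.ofReal_sum]
    refine Finset.sum_congr rfl fun i _ => ?_
    by_cases hz : i = 0
    · subst hz
      rw [h0, if_pos rfl]
      push_cast
      linear_combination (-(x 0 : ℂ) ^ 2) * Complex.I_sq
    · simp [hz, hi i hz, sq]
  rw [h, hx, Complex.ofReal_one]

open Matrix in
theorem im_mulVec_of_mem_Snplus {n : ℕ} (g : Matrix (Fin (n+1)) (Fin (n+1)) ℝ)
    {w : Fin (n+1) → ℂ} (hw : w ∈ Snplus n) (i : Fin (n+1)) :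
    ((g.map Complex.ofReal *ᵥ w) i).im = g i 0 * (w 0).im := by
  obtain ⟨x, -, -, -, hi⟩ := hw
  simp only [mulVec, dotProduct, Complex.im_sum, Matrix.map_apply,
    Complex.im_ofReal_mul]
  refine Finset.sum_eq_single 0 (fun j _ hj => ?_) (by simp)
  simp [hi j hj]

theorem im_zero_pos_of_mem_Snplus {n : ℕ} {w : Fin (n+1) → ℂ} (hw : w ∈ Snplus n) :
    0 < (w 0).im := by
  obtain ⟨x, hx, -, h0, -⟩ := hw
  simpa [h0] using hx

theorem im_zero_pos_of_mem_Xi {n : ℕ} {z : Fin (n+1) → ℂ} (hz : z ∈ Xi n) : 0 < (z 0).im := by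
  obtain ⟨g, w, hg, hw, rfl⟩ := hz
  rw [im_mulVec_of_mem_Snplus g hw]
  exact mul_pos hg.2.2 (im_zero_pos_of_mem_Snplus hw)

open Matrix in
theorem lformR_col_zero {n : ℕ} {g : Matrix (Fin (n+1)) (Fin (n+1)) ℝ}
    (hg : gᵀ * eta n * g = eta n) : lformR n (fun i => g i 0) (fun i => g i 0) = -1 := by
  have h := congrFun (congrFun hg 0) 0
  rw [Matrix.mul_apply] at h
  simp only [eta, Matrix.mul_diagonal, Matrix.transpose_apply, Matrix.diagonal_apply_eq,
    if_true] at h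
  rw [← h, lformR]
  exact Finset.sum_congr rfl fun i _ => by ring

/-- The vectors of the complex quadric `[z,z] = 1` whose imaginary part lies in the closed
forward light cone. -/
def closedTube (n : ℕ) : Set (Fin (n+1) → ℂ) :=
  {z | lformC n z z = 1 ∧ 0 ≤ (z 0).im ∧ lformR n (fun i => (z i).im) (fun i => (z i).im) ≤ 0}

theorem isClosed_closedTube (n : ℕ) : IsClosed (closedTube n) := by
  refine IsClosed.inter (isClosed_eq ?_ continuous_const)
    (IsClosed.inter (isClosed_le (f := fun _ => (0 : ℝ)) continuous_const ?_)
      (isClosed_le (g := fun _ => (0 : ℝ)) ?_ continuous_const))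
  · simp only [lformC]
    fun_prop
  · fun_prop
  · simp only [lformR]
    fun_prop

theorem Xi_subset_closedTube (n : ℕ) : Xi n ⊆ closedTube n := by
  intro z hz
  refine ⟨?_, (im_zero_pos_of_mem_Xi hz).le, ?_⟩ <;> obtain ⟨g, w, hg, hw, rfl⟩ := hz
  · rw [lformC_mulVec hg.1, lformC_self_of_mem_Snplus hw]
  · have h : lformR n (fun i => g i 0 * (w 0).im) (fun i => g i 0 * (w 0).im) =
        (w 0).im ^ 2 * lformR n (fun i => g i 0) (fun i => g i 0) := by
      simp only [lformR, Finset.mul_sum]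
      exact Finset.sum_congr rfl fun i _ => by ring
    simp only [im_mulVec_of_mem_Snplus g hw]
    rw [h, lformR_col_zero hg.1]
    nlinarith [sq_nonneg (w 0).im]

theorem closure_Xi_subset_closedTube (n : ℕ) : closure (Xi n) ⊆ closedTube n :=
  closure_minimal (Xi_subset_closedTube n) (isClosed_closedTube n)

theorem continuous_conjVec (n : ℕ) : Continuous (conjVec n) :=
  continuous_pi fun i => Complex.continuous_conj.comp (continuous_apply i)

theorem conjVec_conjVec {n : ℕ} (z : Fin (n+1) → ℂ) : conjVec n (conjVec n z) = z :=
  funext fun i => Complex.conj_conj (z i)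

theorem conjVec_mem_closure_Xi {n : ℕ} {z : Fin (n+1) → ℂ} (hz : z ∈ closure (XiBar n)) :
    conjVec n z ∈ closure (Xi n) :=
  map_mem_closure (continuous_conjVec n) hz fun _ h => h

theorem conjVec_mem_closure_XiBar {n : ℕ} {z : Fin (n+1) → ℂ} (hz : z ∈ closure (Xi n)) :
    conjVec n z ∈ closure (XiBar n) :=
  map_mem_closure (continuous_conjVec n) hz fun w h => by
    change conjVec n (conjVec n w) ∈ Xi n
    rwa [conjVec_conjVec]

theorem eq_zero_of_lformR_nonpos {n : ℕ} {x : Fin (n+1) → ℝ} (h0 : x 0 = 0)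
    (hx : lformR n x x ≤ 0) : x = 0 := by
  have h : lformR n x x = ∑ i, x i ^ 2 := by
    refine Finset.sum_congr rfl fun i _ => ?_
    by_cases hi : i = 0
    · simp [hi, h0]
    · simp [hi, sq]
  rw [h] at hx
  have h' := (Finset.sum_eq_zero_iff_of_nonneg fun i _ => sq_nonneg (x i)).1
    (le_antisymm hx (Finset.sum_nonneg fun i _ => sq_nonneg (x i)))
  exact funext fun i => by simpa using h' i (Finset.mem_univ i)

/-- `exp (t • M)` for a matrix `M` with `M ^ 3 = M`. -/
noncomputable def boostAlong {n : ℕ} (M : Matrix (Fin (n+1)) (Fin (n+1)) ℝ) (t : ℝ) :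
    Matrix (Fin (n+1)) (Fin (n+1)) ℝ :=
  1 + Real.sinh t • M + (Real.cosh t - 1) • (M * M)

theorem boostAlong_add {n : ℕ} {M : Matrix (Fin (n+1)) (Fin (n+1)) ℝ} (hM : M * M * M = M)
    (s t : ℝ) : boostAlong M (s + t) = boostAlong M s * boostAlong M t := by
  have h4 : M * (M * M) = M := by rw [← mul_assoc, hM]
  have h5 : M * M * (M * M) = M * M := by rw [← mul_assoc, hM]
  simp only [boostAlong, mul_add, add_mul, one_mul, mul_one, smul_mul_assoc, mul_smul_comm,
    hM, h4, h5, Real.sinh_add, Real.cosh_add]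
  module

open Matrix in
theorem boostAlong_transpose_mul_eta_mul {n : ℕ} {M : Matrix (Fin (n+1)) (Fin (n+1)) ℝ}
    (hM : M * M * M = M) (hT : Mᵀ = M) (hη : M * eta n = -(eta n * M)) (t : ℝ) :
    (boostAlong M t)ᵀ * eta n * boostAlong M t = eta n := by
  have hη2 : M * M * eta n = eta n * (M * M) := by
    rw [mul_assoc, hη, mul_neg, ← mul_assoc, hη, neg_mul, neg_neg, mul_assoc]
  have h : (boostAlong M t)ᵀ * eta n = eta n * boostAlong M (-t) := by
    simp only [boostAlong, transpose_add, transpose_one, transpose_smul, transpose_mul, hT,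
      add_mul, mul_add, one_mul, mul_one, smul_mul_assoc, mul_smul_comm, hη, hη2,
      Real.sinh_neg, Real.cosh_neg, smul_neg, neg_smul, mul_neg]
  rw [h, mul_assoc, ← boostAlong_add hM]
  simp [boostAlong]

theorem det_eta_ne_zero (n : ℕ) : (eta n).det ≠ 0 := by
  rw [eta, Matrix.det_diagonal]
  refine Finset.prod_ne_zero_iff.2 fun i _ => ?_
  split_ifs <;> norm_num

theorem det_boostAlong {n : ℕ} {M : Matrix (Fin (n+1)) (Fin (n+1)) ℝ}
    (hM : M * M * M = M) (hT : M.transpose = M) (hη : M * eta n = -(eta n * M)) (t : ℝ) :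
    (boostAlong M t).det = 1 := by
  have h := congrArg Matrix.det (boostAlong_transpose_mul_eta_mul hM hT hη (t / 2))
  rw [Matrix.det_mul, Matrix.det_mul, Matrix.det_transpose] at h
  have ht : boostAlong M t = boostAlong M (t / 2) * boostAlong M (t / 2) := by
    rw [← boostAlong_add hM, add_halves]
  rw [ht, Matrix.det_mul]
  refine mul_right_cancel₀ (det_eta_ne_zero n) ?_
  linear_combination h

open Matrix in
/-- The generator of the boosts in the plane spanned by `e₀` and `e`. -/
def boostGenerator {n : ℕ} (e : Fin (n+1) → ℝ) : Matrix (Fin (n+1)) (Fin (n+1)) ℝ :=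
  vecMulVec e (e0 n) + vecMulVec (e0 n) e

open Matrix in
theorem boostGenerator_mulVec_e0 {n : ℕ} {e : Fin (n+1) → ℝ} (h0 : e 0 = 0) :
    boostGenerator e *ᵥ e0 n = e := by
  have he0 : e0 n ⬝ᵥ e0 n = 1 := by simp [e0_eq_single]
  have he : e ⬝ᵥ e0 n = 0 := by simp [e0_eq_single, h0]
  simp [boostGenerator, add_mulVec, vecMulVec_mulVec, he0, he]

open Matrix in
theorem boostGenerator_mulVec_self {n : ℕ} {e : Fin (n+1) → ℝ} (h0 : e 0 = 0)
    (h1 : e ⬝ᵥ e = 1) : boostGenerator e *ᵥ e = e0 n := by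
  simp [boostGenerator, add_mulVec, vecMulVec_mulVec, e0_eq_single, h0, h1]

open Matrix in
theorem boostAlong_boostGenerator_mulVec_self {n : ℕ} {e : Fin (n+1) → ℝ} (h0 : e 0 = 0)
    (h1 : e ⬝ᵥ e = 1) (t : ℝ) :
    boostAlong (boostGenerator e) t *ᵥ e = Real.sinh t • e0 n + Real.cosh t • e := by
  simp only [boostAlong, add_mulVec, one_mulVec, smul_mulVec, ← mulVec_mulVec,
    boostGenerator_mulVec_self h0 h1, boostGenerator_mulVec_e0 h0]
  module

open Matrix in
theorem boostAlong_boostGenerator_mulVec_e0 {n : ℕ} {e : Fin (n+1) → ℝ} (h0 : e 0 = 0)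
    (h1 : e ⬝ᵥ e = 1) (t : ℝ) :
    boostAlong (boostGenerator e) t *ᵥ e0 n = Real.cosh t • e0 n + Real.sinh t • e := by
  simp only [boostAlong, add_mulVec, one_mulVec, smul_mulVec, ← mulVec_mulVec,
    boostGenerator_mulVec_self h0 h1, boostGenerator_mulVec_e0 h0]
  module

open Matrix in
theorem memG_boostAlong_boostGenerator {n : ℕ} {e : Fin (n+1) → ℝ} (h0 : e 0 = 0)
    (h1 : e ⬝ᵥ e = 1) (t : ℝ) : memG n (boostAlong (boostGenerator e) t) := by
  have hM : boostGenerator e * boostGenerator e * boostGenerator e = boostGenerator e := by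
    have hsq : boostGenerator e * boostGenerator e = vecMulVec (e0 n) (e0 n) + vecMulVec e e := by
      nth_rw 2 [boostGenerator]
      simp only [mul_add, mul_vecMulVec, boostGenerator_mulVec_self h0 h1,
        boostGenerator_mulVec_e0 h0]
    rw [mul_assoc, hsq]
    simp only [mul_add, mul_vecMulVec, boostGenerator_mulVec_self h0 h1,
      boostGenerator_mulVec_e0 h0]
    rfl
  have hT : (boostGenerator e)ᵀ = boostGenerator e := by
    simp [boostGenerator, transpose_vecMulVec, add_comm]
  have hη : boostGenerator e * eta n = -(eta n * boostGenerator e) := by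
    ext i j
    by_cases hi : i = 0 <;> by_cases hj : j = 0 <;>
      simp [boostGenerator, eta, vecMulVec_apply, e0, hi, hj, h0]
  refine ⟨boostAlong_transpose_mul_eta_mul hM hT hη t, det_boostAlong hM hT hη t, ?_⟩
  have h := congrFun (boostAlong_boostGenerator_mulVec_e0 h0 h1 t) 0
  rw [e0_eq_single, mulVec_single_one] at h
  simp only [col_apply, Pi.add_apply, Pi.smul_apply, Pi.single_eq_same, h0, smul_eq_mul,
    mul_one, mul_zero, add_zero] at h
  rw [h]
  exact Real.cosh_pos t

open Matrix in
theorem exists_memG_mulVec_eq {n : ℕ} {u : Fin (n+1) → ℝ} (hu : lformR n u u = 1) :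
    ∃ g e, memG n g ∧ e 0 = 0 ∧ e ⬝ᵥ e = 1 ∧ g *ᵥ e = u := by
  have hsum : ∑ i : Fin n, u i.succ ^ 2 = 1 + u 0 ^ 2 := by
    simp only [lformR, Fin.sum_univ_succ, if_true, Fin.succ_ne_zero, if_false] at hu
    simp only [sq]
    simp only [one_mul] at hu
    linarith
  set t := Real.arsinh (u 0)
  have hc : Real.cosh t ^ 2 = 1 + u 0 ^ 2 := by
    rw [Real.cosh_sq, Real.sinh_arsinh]; ring
  have hc0 : Real.cosh t ≠ 0 := (Real.cosh_pos t).ne'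
  set e : Fin (n+1) → ℝ := fun i => if i = 0 then 0 else u i / Real.cosh t with he
  have h0 : e 0 = 0 := by simp [he]
  have h1 : e ⬝ᵥ e = 1 := by
    simp only [dotProduct, Fin.sum_univ_succ, he, if_true, Fin.succ_ne_zero, if_false]
    simp only [← sq, div_pow, ← Finset.sum_div, hsum, hc]
    field_simp
    simp
  refine ⟨_, e, memG_boostAlong_boostGenerator h0 h1 t, h0, h1, ?_⟩
  rw [boostAlong_boostGenerator_mulVec_self h0 h1]
  ext i
  by_cases hi : i = 0
  · simp [hi, h0, e0, t]
  · simp [hi, he, e0]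
    field_simp

open Matrix in
theorem dSC_subset_closure_Xi (n : ℕ) : dSC n ⊆ closure (Xi n) := by
  rintro z ⟨him, hz⟩
  have hre : ∀ i, z i = ((z i).re : ℂ) := fun i => Complex.ext rfl (him i)
  have hu : lformR n (fun i => (z i).re) (fun i => (z i).re) = 1 := by
    rw [← Complex.ofReal_inj, Complex.ofReal_one, ← hz]
    simp only [lformR, lformC, Complex.ofReal_sum]
    refine Finset.sum_congr rfl fun i _ => ?_
    rw [hre i]
    split_ifs <;> simp
  obtain ⟨g, e, hg, h0, h1, hge⟩ := exists_memG_mulVec_eq hu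
  let w : ℝ → Fin (n+1) → ℂ := fun τ i =>
    if i = 0 then Complex.I * (Real.sin τ : ℂ) else ((Real.cos τ * e i : ℝ) : ℂ)
  have hw : Continuous w := by
    refine continuous_pi fun i => ?_
    by_cases hi : i = 0 <;> simp only [w, hi, if_true, if_false] <;> fun_prop
  have hlim : Tendsto (fun τ => g.map Complex.ofReal *ᵥ w τ) (𝓝[>] 0)
      (𝓝 (g.map Complex.ofReal *ᵥ w 0)) :=
    ((Continuous.matrix_mulVec continuous_const hw).tendsto 0).mono_left nhdsWithin_le_nhds
  have hz0 : g.map Complex.ofReal *ᵥ w 0 = z := by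
    have hw0 : w 0 = fun i => (e i : ℂ) := by
      ext i
      by_cases hi : i = 0 <;> simp [w, hi, h0]
    ext i
    rw [hre i, hw0, ← congrFun hge i]
    simp [mulVec, dotProduct]
  rw [← hz0]
  refine mem_closure_of_tendsto hlim ?_
  filter_upwards [Ioo_mem_nhdsGT Real.pi_pos] with τ hτ
  refine ⟨g, w τ, hg, ⟨fun i => if i = 0 then Real.sin τ else Real.cos τ * e i, ?_, ?_, ?_, ?_⟩,
    rfl⟩
  · simpa using Real.sin_pos_of_mem_Ioo hτ
  · have h1' : ∑ i : Fin n, e i.succ ^ 2 = 1 := by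
      simpa [dotProduct, Fin.sum_univ_succ, h0, sq] using h1
    simp [Fin.sum_univ_succ, Fin.succ_ne_zero, mul_pow, ← Finset.mul_sum, h1']
  · simp [w]
  · intro i hi
    simp [w, hi]

theorem stmt2 (n : ℕ) (hn : 2 ≤ n) :
    dSC n = (closure (Xi n) \ Xi n) ∩ (closure (XiBar n) \ XiBar n) := by
  refine Set.Subset.antisymm (fun z hz => ?_) ?_
  · have hconj : conjVec n z = z := funext fun i => Complex.conj_eq_iff_im.2 (hz.1 i)
    have hcl := dSC_subset_closure_Xi n hz
    have hXi : z ∉ Xi n := fun h => (im_zero_pos_of_mem_Xi h).ne' (hz.1 0)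
    refine ⟨⟨hcl, hXi⟩, hconj ▸ conjVec_mem_closure_XiBar hcl, fun h => hXi ?_⟩
    exact hconj ▸ (show conjVec n z ∈ Xi n from h)
  · rintro z ⟨⟨hz, -⟩, hzbar, -⟩
    obtain ⟨hq, hpos, hcone⟩ := closure_Xi_subset_closedTube n hz
    obtain ⟨-, hneg, -⟩ := closure_Xi_subset_closedTube n (conjVec_mem_closure_Xi hzbar)
    have h0 : (z 0).im = 0 := le_antisymm (by simpa [conjVec] using hneg) hpos
    exact ⟨congrFun (eq_zero_of_lformR_nonpos (x := fun i => (z i).im) h0 hcone), hq⟩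
end

section
/- Let n ≥ 2. For all z, w in the crown Ξ, the number (1 + [z, conj w])/2 lies in ℂ ∖ [1,∞); consequently the kernel Ψ_λ(z,w) = F_λ((1+[z, conj w])/2) is well defined on Ξ × Ξ. -/
open scoped BigOperators
open Filter Topology

theorem lformR_eq_dotProduct (n : ℕ) (x y : Fin (n+1) → ℝ) :
    lformR n x y = x ⬝ᵥ (eta n).mulVec y := by
  simp only [lformR, eta, dotProduct, Matrix.mulVec_diagonal]
  exact Finset.sum_congr rfl fun i _ => by ring

theorem lformR_comm (n : ℕ) (x y : Fin (n+1) → ℝ) : lformR n x y = lformR n y x :=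
  Finset.sum_congr rfl fun i _ => by ring

theorem lformR_add_left (n : ℕ) (x y z : Fin (n+1) → ℝ) :
    lformR n (x + y) z = lformR n x z + lformR n y z := by
  simp only [lformR, ← Finset.sum_add_distrib, Pi.add_apply]
  exact Finset.sum_congr rfl fun i _ => by ring

theorem lformR_sub_left (n : ℕ) (x y z : Fin (n+1) → ℝ) :
    lformR n (x - y) z = lformR n x z - lformR n y z := by
  simp only [lformR, ← Finset.sum_sub_distrib, Pi.sub_apply]
  exact Finset.sum_congr rfl fun i _ => by ring

theorem lformR_eq_sum_succ (n : ℕ) (x y : Fin (n+1) → ℝ) :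
    lformR n x y = -(x 0 * y 0) + ∑ i : Fin n, x i.succ * y i.succ := by
  simp [lformR, Fin.sum_univ_succ, Fin.succ_ne_zero]

theorem lformR_mulVec (n : ℕ) {g : Matrix (Fin (n+1)) (Fin (n+1)) ℝ} (hg : memG n g)
    (x y : Fin (n+1) → ℝ) : lformR n (g.mulVec x) (g.mulVec y) = lformR n x y := by
  rw [lformR_eq_dotProduct, lformR_eq_dotProduct]
  conv_rhs => rw [← hg.1, ← Matrix.mulVec_mulVec, ← Matrix.mulVec_mulVec,
    Matrix.dotProduct_mulVec, Matrix.vecMul_transpose]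

/-- The spatial Cauchy–Schwarz inequality. -/
theorem sq_sum_succ_le (n : ℕ) (x y : Fin (n+1) → ℝ) :
    (lformR n x y + x 0 * y 0) ^ 2 ≤
      (lformR n x x + x 0 * x 0) * (lformR n y y + y 0 * y 0) := by
  simp only [lformR_eq_sum_succ, neg_add_cancel_comm]
  simpa only [← pow_two] using
    Finset.sum_mul_sq_le_sq_mul_sq Finset.univ (fun i : Fin n => x i.succ) (fun i => y i.succ)

theorem lformR_self_add_nonneg (n : ℕ) (x : Fin (n+1) → ℝ) :
    0 ≤ lformR n x x + x 0 * x 0 := by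
  simp only [lformR_eq_sum_succ, neg_add_cancel_comm]
  exact Finset.sum_nonneg fun i _ => mul_self_nonneg _

/-- Two future-directed timelike vectors have negative Lorentzian product. -/
theorem lformR_neg_of_timelike (n : ℕ) {x y : Fin (n+1) → ℝ} (hx : lformR n x x < 0)
    (hx0 : 0 < x 0) (hy : lformR n y y < 0) (hy0 : 0 < y 0) : lformR n x y < 0 := by
  have h : (lformR n x y + x 0 * y 0) ^ 2 < (x 0 * y 0) ^ 2 := by
    have := mul_lt_mul'' (show lformR n x x + x 0 * x 0 < x 0 * x 0 by linarith)
      (show lformR n y y + y 0 * y 0 < y 0 * y 0 by linarith)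
      (lformR_self_add_nonneg n x) (lformR_self_add_nonneg n y)
    nlinarith [sq_sum_succ_le n x y]
  linarith [lt_of_pow_lt_pow_left₀ 2 (by positivity) h]

/-- A vector orthogonal to a timelike vector is not timelike. -/
theorem lformR_self_nonneg_of_orthogonal (n : ℕ) {x y : Fin (n+1) → ℝ}
    (hy : lformR n y y < 0) (hxy : lformR n x y = 0) : 0 ≤ lformR n x x := by
  have h := sq_sum_succ_le n x y
  rw [hxy] at h
  have hx := lformR_self_add_nonneg n x
  have hy' := lformR_self_add_nonneg n y
  by_contra! hneg
  have hpos : 0 < y 0 * y 0 := by linarith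
  nlinarith [mul_nonneg hx (neg_nonneg.2 hy.le), mul_pos (neg_pos.2 hneg) hpos]

/-- The real and imaginary parts of a point of the crown: the imaginary part is future-directed
timelike, and `[z,z] = 1`. -/
theorem re_im_of_mem_Xi (n : ℕ) {z : Fin (n+1) → ℂ} (hz : z ∈ Xi n) :
    lformR n (fun i => (z i).re) (fun i => (z i).re)
        - lformR n (fun i => (z i).im) (fun i => (z i).im) = 1 ∧
      lformR n (fun i => (z i).re) (fun i => (z i).im) = 0 ∧
      lformR n (fun i => (z i).im) (fun i => (z i).im) < 0 ∧ 0 < (z 0).im := by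
  obtain ⟨g, s, hg, ⟨x, hx0, hx1, hs0, hs⟩, rfl⟩ := hz
  have hre : (fun i => ((g.map Complex.ofReal).mulVec s i).re)
      = g.mulVec (fun i => (s i).re) := by
    ext i; simp [Matrix.mulVec, dotProduct]
  have him : (fun i => ((g.map Complex.ofReal).mulVec s i).im)
      = g.mulVec (fun i => (s i).im) := by
    ext i; simp [Matrix.mulVec, dotProduct]
  have h0 := congrFun him 0
  rw [hre, him, h0, lformR_mulVec n hg, lformR_mulVec n hg, lformR_mulVec n hg]
  have hsucc (i : Fin n) : s i.succ = x i.succ := hs _ (Fin.succ_ne_zero i)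
  rw [Fin.sum_univ_succ] at hx1
  simp only [lformR_eq_sum_succ, hs0, hsucc, Matrix.mulVec, dotProduct, Fin.sum_univ_succ]
  have hg0 := hg.2.2
  simp only [← pow_two]
  simp
  refine ⟨by linarith, by positivity, by positivity⟩

theorem lformC_conjVec_re (n : ℕ) (z w : Fin (n+1) → ℂ) :
    (lformC n z (conjVec n w)).re = lformR n (fun i => (z i).re) (fun i => (w i).re)
      + lformR n (fun i => (z i).im) (fun i => (w i).im) := by
  simp only [lformC, lformR, conjVec, Complex.re_sum, ← Finset.sum_add_distrib]
  refine Finset.sum_congr rfl fun i _ => ?_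
  split_ifs
  · simp; ring
  · simp

theorem lformC_conjVec_im (n : ℕ) (z w : Fin (n+1) → ℂ) :
    (lformC n z (conjVec n w)).im = lformR n (fun i => (z i).im) (fun i => (w i).re)
      - lformR n (fun i => (z i).re) (fun i => (w i).im) := by
  simp only [lformC, lformR, conjVec, Complex.im_sum, ← Finset.sum_sub_distrib]
  refine Finset.sum_congr rfl fun i _ => ?_
  split_ifs
  · simp
  · simp; ring

theorem stmt4 (n : ℕ) (hn : 2 ≤ n) :
    ∀ z ∈ Xi n, ∀ w ∈ Xi n, (1 + lformC n z (conjVec n w))/2 ∉ slit := by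
  rintro z hz w hw ⟨him, hre⟩
  replace him : (lformC n z (conjVec n w)).im = 0 := by simpa using him
  replace hre : 1 ≤ (lformC n z (conjVec n w)).re := by
    simp at hre
    linarith
  rw [lformC_conjVec_im] at him
  rw [lformC_conjVec_re] at hre
  obtain ⟨hz1, hz2, hz3, hz4⟩ := re_im_of_mem_Xi n hz
  obtain ⟨hw1, hw2, hw3, hw4⟩ := re_im_of_mem_Xi n hw
  set x := fun i => (z i).re
  set y := fun i => (z i).im
  set u := fun i => (w i).re
  set v := fun i => (w i).im
  have hyv := lformR_neg_of_timelike n hz3 hz4 hw3 hw4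
  have hadd : lformR n (y + v) (y + v) = lformR n y y + 2 * lformR n y v + lformR n v v := by
    rw [lformR_add_left, lformR_comm n y, lformR_comm n v, lformR_add_left, lformR_add_left,
      lformR_comm n v y]
    ring
  have hsub : lformR n (x - u) (x - u) = lformR n x x - 2 * lformR n x u + lformR n u u := by
    rw [lformR_sub_left, lformR_comm n x, lformR_comm n u, lformR_sub_left, lformR_sub_left,
      lformR_comm n u x]
    ring
  have horth : lformR n (x - u) (y + v) = 0 := by
    rw [lformR_sub_left, lformR_comm n x, lformR_comm n u, lformR_add_left, lformR_add_left,
      lformR_comm n y x, lformR_comm n v x, lformR_comm n v u]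
    linarith
  have := lformR_self_nonneg_of_orthogonal n (by linarith) horth
  linarith
end
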